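/- If 1 ≤ p < ∞ and u is a weight on (0,∞)² belonging to B_p((0,∞)²), then there exists ε with 0 < ε < p such that u belongs to B_{p−ε}((0,∞)²). -/

import Mathlib

open MeasureTheory Set
open scoped ENNReal NNReal

/-- A set `D ⊆ (0,∞)²` is decreasing if its indicator is decreasing in each variable. -/
def DecSet2 (D : Set (ℝ × ℝ)) : Prop :=
  D ⊆ Set.Ioi 0 ×ˢ Set.Ioi 0 ∧
    ∀ z ∈ D, ∀ w : ℝ × ℝ, 0 < w.1 → w.1 ≤ z.1 → 0 < w.2 → w.2 ≤ z.2 → w ∈ D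

/-- The `B_p((0,∞)²)` condition for a weight `u` on `(0,∞)²`. -/
def Bp2 (u : ℝ × ℝ → ℝ≥0) (p : ℝ) : Prop :=
  ∃ C : ℝ, 0 < C ∧ ∀ D : Set (ℝ × ℝ), DecSet2 D →
    ∫⁻ z in (Set.Ioi (0 : ℝ) ×ˢ Set.Ioi (0 : ℝ)) \ D,
        (volume (D ∩ (Set.Ioc 0 z.1 ×ˢ Set.Ioc 0 z.2)) / ENNReal.ofReal (z.1 * z.2)) ^ p *
          (u z : ℝ≥0∞) ≤
      ENNReal.ofReal C * ∫⁻ z in D, (u z : ℝ≥0∞)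

/-- A discrete self-improvement (Gehring-type) principle: if the tails of the weighted series
`∑ r ^ j * d j` are controlled by the partial sums of `d`, then so is the series with a slightly
larger ratio. -/
lemma exists_ratio_sum_le {r K : ℝ} (hr : 0 < r) (hr1 : r < 1) (hK : 0 < K) :
    ∃ θ : ℝ, 1 < θ ∧ θ * r < 1 ∧ ∀ (a : ℝ) (d : ℕ → ℝ), (∀ i, 0 ≤ d i) → 0 ≤ a →
      (∀ k N, ∑ j ∈ Finset.Ico k N, r ^ j * d j ≤
        K * r ^ k * (a + ∑ i ∈ Finset.Ico 0 k, d i)) →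
      ∀ N, ∑ j ∈ Finset.Ico 0 N, (θ * r) ^ j * d j ≤ (2 * K + 1) * a := by
  obtain ⟨η, hηdef⟩ : ∃ η, η = (1 - r) / (r * (2 * K + 1)) := ⟨_, rfl⟩
  have hη : 0 < η := by
    rw [hηdef]; exact div_pos (by linarith) (by positivity)
  have hηeq : η * r * (2 * K + 1) = 1 - r := by rw [hηdef]; field_simp
  obtain ⟨ρ, hρ⟩ : ∃ ρ, ρ = (1 + η) * r := ⟨_, rfl⟩
  have hρ0 : 0 < ρ := by rw [hρ]; positivity
  have hρhalf : η * K * r = (1 - ρ) / 2 := by rw [hρ]; linarith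
  have hρ1 : ρ < 1 := by
    have : 0 < η * K * r := by positivity
    linarith
  refine ⟨1 + η, by linarith, by rwa [← hρ], fun a d hd ha h N => ?_⟩
  rw [← hρ]
  have hpow (j : ℕ) : (1 + η) ^ j = 1 + η * ∑ k ∈ Finset.Ico 0 j, (1 + η) ^ k := by
    have := geom_sum_mul (1 + η) j
    rw [← Finset.range_eq_Ico]
    linarith
  have hsplit : ∑ j ∈ Finset.Ico 0 N, ρ ^ j * d j = ∑ j ∈ Finset.Ico 0 N, r ^ j * d j +
      η * ∑ k ∈ Finset.Ico 0 N, (1 + η) ^ k * ∑ j ∈ Finset.Ico (k + 1) N, r ^ j * d j := by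
    simp_rw [Finset.mul_sum]
    rw [Finset.sum_Ico_Ico_comm', ← Finset.sum_add_distrib]
    refine Finset.sum_congr rfl fun j _ => ?_
    rw [hρ, mul_pow, hpow j, ← Finset.mul_sum, ← Finset.sum_mul]
    ring
  have htail : ∑ k ∈ Finset.Ico 0 N, (1 + η) ^ k * ∑ j ∈ Finset.Ico (k + 1) N, r ^ j * d j ≤
      K * r * (a * ∑ k ∈ Finset.Ico 0 N, ρ ^ k +
        ∑ k ∈ Finset.Ico 0 N, ∑ i ∈ Finset.Ico 0 (k + 1), ρ ^ k * d i) := by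
    rw [Finset.mul_sum, ← Finset.sum_add_distrib, Finset.mul_sum]
    refine Finset.sum_le_sum fun k _ => ?_
    calc _ ≤ (1 + η) ^ k * (K * r ^ (k + 1) * (a + ∑ i ∈ Finset.Ico 0 (k + 1), d i)) := by
          gcongr; exact h _ _
      _ = _ := by rw [← Finset.mul_sum, hρ, mul_pow]; ring
  have hgeom (m : ℕ) : ∑ k ∈ Finset.Ico m N, ρ ^ k ≤ ρ ^ m / (1 - ρ) :=
    geom_sum_Ico_le_of_lt_one hρ0.le hρ1
  have hdouble : ∑ k ∈ Finset.Ico 0 N, ∑ i ∈ Finset.Ico 0 (k + 1), ρ ^ k * d i ≤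
      (∑ j ∈ Finset.Ico 0 N, ρ ^ j * d j) / (1 - ρ) := by
    rw [← Finset.sum_Ico_Ico_comm 0 N fun i k => ρ ^ k * d i, Finset.sum_div]
    refine Finset.sum_le_sum fun i _ => ?_
    rw [← Finset.sum_mul, mul_div_right_comm]
    gcongr
    · exact hd i
    · exact hgeom i
  have h0 : ∑ j ∈ Finset.Ico 0 N, r ^ j * d j ≤ K * a := by simpa using h 0 N
  have h1ρ : 0 < 1 - ρ := by linarith
  have hfirst : a * ∑ k ∈ Finset.Ico 0 N, ρ ^ k ≤ a / (1 - ρ) := by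
    calc _ ≤ a * (ρ ^ 0 / (1 - ρ)) := by gcongr; exact hgeom 0
      _ = _ := by simp [div_eq_mul_inv]
  set S := ∑ j ∈ Finset.Ico 0 N, ρ ^ j * d j
  have hS : S ≤ K * a + η * (K * r * (a / (1 - ρ) + S / (1 - ρ))) := by
    refine hsplit.trans_le (add_le_add h0 (mul_le_mul_of_nonneg_left (htail.trans ?_) hη.le))
    gcongr
  have hc : η * (K * r * (a / (1 - ρ) + S / (1 - ρ))) = (a + S) / 2 := by
    rw [← add_div, ← mul_assoc, ← mul_assoc, hρhalf]
    field_simp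
  linarith

namespace DecSet2

variable {D : Set (ℝ × ℝ)}

lemma nullMeasurableSet (hD : DecSet2 D) : NullMeasurableSet D := by
  have hpre : (MeasurableEquiv.finTwoArrow (α := ℝ) ⁻¹' D).OrdConnected := by
    refine ⟨fun x hx y hy z hz => ?_⟩
    have hx' := hD.1 hx
    exact hD.2 _ hy _ (lt_of_lt_of_le hx'.1 (hz.1 0)) (hz.2 0)
      (lt_of_lt_of_le hx'.2 (hz.1 1)) (hz.2 1)
  have hmp := (volume_preserving_finTwoArrow ℝ).symm
  have := hpre.nullMeasurableSet.preimage hmp.quasiMeasurePreserving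
  rwa [← preimage_comp, MeasurableEquiv.self_comp_symm, preimage_id] at this

end DecSet2

lemma volume_Ioc_prod_Ioc {a b : ℝ} (ha : 0 ≤ a) :
    volume (Ioc 0 a ×ˢ Ioc 0 b) = ENNReal.ofReal (a * b) := by
  rw [Measure.volume_eq_prod, Measure.prod_prod, Real.volume_Ioc, Real.volume_Ioc, sub_zero,
    sub_zero, ENNReal.ofReal_mul ha]

/-- If a positive diagonal map sends `A` into `B`, the measures compare by its determinant. -/
lemma ofReal_mul_volume_le_of_mapsTo {α β : ℝ} (hα : 0 < α) (hβ : 0 < β) {A B : Set (ℝ × ℝ)}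
    (h : MapsTo (fun z : ℝ × ℝ => (α * z.1, β * z.2)) A B) :
    ENNReal.ofReal (α * β) * volume A ≤ volume B := by
  have hmap : Measure.map (Prod.map (α * ·) (β * ·)) (volume : Measure (ℝ × ℝ)) =
      ENNReal.ofReal (α⁻¹ * β⁻¹) • volume := by
    rw [Measure.volume_eq_prod, ← Measure.map_prod_map _ _ (measurable_const_mul α)
      (measurable_const_mul β), Real.map_volume_mul_left hα.ne', Real.map_volume_mul_left hβ.ne',
      Measure.prod_smul_left, Measure.prod_smul_right, smul_smul, abs_of_pos (inv_pos.2 hα),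
      abs_of_pos (inv_pos.2 hβ), ENNReal.ofReal_mul (inv_pos.2 hα).le]
  have hB := Measure.le_map_apply (μ := (volume : Measure (ℝ × ℝ)))
    (((measurable_const_mul α).prodMap (measurable_const_mul β)).aemeasurable) B
  rw [hmap, Measure.smul_apply, smul_eq_mul] at hB
  calc _ ≤ ENNReal.ofReal (α * β) * (ENNReal.ofReal (α⁻¹ * β⁻¹) * volume B) := by
        gcongr
        exact (measure_mono h).trans hB
    _ = volume B := by
        rw [← mul_assoc, ← ENNReal.ofReal_mul (by positivity),
          show α * β * (α⁻¹ * β⁻¹) = 1 by field_simp, ENNReal.ofReal_one, one_mul]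

/-- The part of `(0,∞)²` where the average of the indicator of `D` over the rectangle
`(0,x] × (0,y]` is at least `t`. -/
def avgLevelSet (D : Set (ℝ × ℝ)) (t : ℝ) : Set (ℝ × ℝ) :=
  {z | (0 < z.1 ∧ 0 < z.2) ∧
    ENNReal.ofReal (t * (z.1 * z.2)) ≤ volume (D ∩ (Ioc 0 z.1 ×ˢ Ioc 0 z.2))}

namespace DecSet2

variable {D : Set (ℝ × ℝ)}

lemma avgLevelSet (hD : DecSet2 D) (t : ℝ) : DecSet2 (avgLevelSet D t) := by
  refine ⟨fun z hz => hz.1, fun z hz w hw1 hwz1 hw2 hwz2 => ⟨⟨hw1, hw2⟩, ?_⟩⟩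
  obtain ⟨⟨hz1, hz2⟩, hz⟩ := hz
  refine le_trans ?_ (ofReal_mul_volume_le_of_mapsTo (div_pos hw1 hz1) (div_pos hw2 hz2)
    (A := D ∩ (Ioc 0 z.1 ×ˢ Ioc 0 z.2)) ?_)
  · refine le_trans (le_of_eq ?_) (mul_le_mul_right hz _)
    rw [← ENNReal.ofReal_mul (by positivity)]
    congr 1
    field_simp
  · rintro ⟨x, y⟩ ⟨hxD, ⟨hx0, hx⟩, hy0, hy⟩
    simp only at hx0 hx hy0 hy
    have e1 : w.1 / z.1 * x ≤ x := mul_le_of_le_one_left hx0.le ((div_le_one hz1).2 hwz1)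
    have e2 : w.2 / z.2 * y ≤ y := mul_le_of_le_one_left hy0.le ((div_le_one hz2).2 hwz2)
    have p1 : 0 < w.1 / z.1 * x := by positivity
    have p2 : 0 < w.2 / z.2 * y := by positivity
    refine ⟨hD.2 _ hxD _ p1 e1 p2 e2, ⟨p1, ?_⟩, p2, ?_⟩
    · simpa [hz1.ne'] using mul_le_mul_of_nonneg_left hx (div_pos hw1 hz1).le
    · simpa [hz2.ne'] using mul_le_mul_of_nonneg_left hy (div_pos hw2 hz2).le

lemma Ioc_prod_Ioc_subset (hD : DecSet2 D) {z : ℝ × ℝ} (hz : z ∈ D) :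
    Ioc 0 z.1 ×ˢ Ioc 0 z.2 ⊆ D :=
  fun w hw => hD.2 z hz w hw.1.1 hw.1.2 hw.2.1 hw.2.2

lemma ofReal_le_volume_inter (hD : DecSet2 D) {x y : ℝ} (h : (x, y) ∈ D) {x' y' : ℝ}
    (hx : x ≤ x') (hy : y ≤ y') :
    ENNReal.ofReal (x * y) ≤ volume (D ∩ (Ioc 0 x' ×ˢ Ioc 0 y')) := by
  rw [← volume_Ioc_prod_Ioc (hD.1 h).1.le]
  exact measure_mono fun w hw => ⟨hD.Ioc_prod_Ioc_subset h hw,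
    ⟨hw.1.1, hw.1.2.trans hx⟩, hw.2.1, hw.2.2.trans hy⟩

lemma subset_avgLevelSet (hD : DecSet2 D) {t : ℝ} (ht : t ≤ 1) : D ⊆ _root_.avgLevelSet D t := by
  intro z hz
  have hpos := hD.1 hz
  refine ⟨hpos, le_trans ?_ (hD.ofReal_le_volume_inter (x := z.1) (y := z.2) hz le_rfl le_rfl)⟩
  exact ENNReal.ofReal_le_ofReal (mul_le_of_le_one_left (mul_pos hpos.1 hpos.2).le ht)

/-- A sharp reverse weak-type estimate: inside a rectangle where the average of `D` is at most `t`,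
`D` fills at most the fraction `t` of its level set `avgLevelSet D t`. -/
lemma volume_inter_le (hD : DecSet2 D) {t : ℝ} (ht : 0 < t) (ht1 : t ≤ 1) {a b : ℝ} (ha : 0 < a)
    (hb : 0 < b) (h : volume (D ∩ (Ioc 0 a ×ˢ Ioc 0 b)) ≤ ENNReal.ofReal (t * (a * b))) :
    volume (D ∩ (Ioc 0 a ×ˢ Ioc 0 b)) ≤
      ENNReal.ofReal t * volume (_root_.avgLevelSet D t ∩ (Ioc 0 a ×ˢ Ioc 0 b)) := by
  set O := _root_.avgLevelSet D t
  have hO : DecSet2 O := hD.avgLevelSet t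
  set T : Set ℝ := {x | x ≤ a ∧ (x, b) ∈ O}
  have hTa : BddAbove T := ⟨a, fun x hx => hx.1⟩
  set x₀ := sSup T
  have hx₀ : 0 ≤ x₀ := Real.sSup_nonneg fun x hx => (hO.1 hx.2).1.le
  have hx₀a : x₀ ≤ a := Real.sSup_le (fun x hx => hx.1) ha.le
  have hnot {x : ℝ} (hx : x₀ < x) (hxa : x ≤ a) : (x, b) ∉ O := fun hxO =>
    hx.not_ge (le_csSup hTa ⟨hxa, hxO⟩)
  have hleft : volume (D ∩ (Ioc 0 x₀ ×ˢ Ioc 0 b)) ≤ ENNReal.ofReal (t * (x₀ * b)) := by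
    rcases hx₀a.eq_or_lt with heq | hlt
    · rwa [heq]
    · have htend : Filter.Tendsto (fun x => ENNReal.ofReal (t * (x * b)))
          (nhdsWithin x₀ (Ioi x₀)) (nhds (ENNReal.ofReal (t * (x₀ * b)))) :=
        ((ENNReal.continuous_ofReal.comp (by fun_prop : Continuous fun x => t * (x * b))).tendsto
          x₀).mono_left nhdsWithin_le_nhds
      refine ge_of_tendsto htend ?_
      filter_upwards [Ioc_mem_nhdsGT hlt] with x hx
      refine le_trans (measure_mono ?_)
        (le_of_not_ge fun hle => hnot hx.1 hx.2 ⟨⟨hx₀.trans_lt hx.1, hb⟩, hle⟩)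
      gcongr
      exact hx.1.le
  have hright : volume (D ∩ (Ioc x₀ a ×ˢ Ioc 0 b)) ≤
      ENNReal.ofReal t * volume (O ∩ (Ioc x₀ a ×ˢ Ioc 0 b)) := by
    have hmaps : MapsTo (fun z : ℝ × ℝ => (1 * z.1, t⁻¹ * z.2)) (D ∩ (Ioc x₀ a ×ˢ Ioc 0 b))
        (O ∩ (Ioc x₀ a ×ˢ Ioc 0 b)) := by
      rintro ⟨x, y⟩ ⟨hxD, ⟨hx0, hx⟩, hy0, hy⟩
      simp only at hx0 hx hy0 hy
      have hxpos : 0 < x := hx₀.trans_lt hx0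
      have hyle : t⁻¹ * y ≤ b := by
        by_contra! hlt
        refine hnot hx0 hx ⟨⟨hxpos, hb⟩, le_trans (ENNReal.ofReal_le_ofReal ?_)
          (hD.ofReal_le_volume_inter hxD le_rfl hy)⟩
        rw [inv_mul_eq_div, lt_div_iff₀ ht] at hlt
        nlinarith
      have hty : y ≤ t⁻¹ * y := le_mul_of_one_le_left hy0.le ((one_le_inv₀ ht).2 ht1)
      simp only [one_mul]
      refine ⟨⟨⟨hxpos, by positivity⟩, le_trans (ENNReal.ofReal_le_ofReal (le_of_eq ?_))
        (hD.ofReal_le_volume_inter hxD le_rfl hty)⟩, ⟨hx0, hx⟩, by positivity, hyle⟩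
      field_simp
    have := ofReal_mul_volume_le_of_mapsTo one_pos (inv_pos.2 ht) hmaps
    calc _ = ENNReal.ofReal t * (ENNReal.ofReal (1 * t⁻¹) *
            volume (D ∩ (Ioc x₀ a ×ˢ Ioc 0 b))) := by
          rw [← mul_assoc, ← ENNReal.ofReal_mul ht.le, one_mul, mul_inv_cancel₀ ht.ne',
            ENNReal.ofReal_one, one_mul]
      _ ≤ _ := by gcongr
  have hcol : Ioo 0 x₀ ×ˢ Ioc 0 b ⊆ O := by
    rintro ⟨x, y⟩ ⟨⟨hx0, hx⟩, hy0, hy⟩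
    simp only at hx0 hx hy0 hy
    have hT : T.Nonempty := by
      by_contra! hT
      have : x₀ = 0 := by simp [x₀, hT]
      linarith
    obtain ⟨x', hx', hlt⟩ := exists_lt_of_lt_csSup hT hx
    exact hO.2 _ hx'.2 _ hx0 hlt.le hy0 hy
  have hdisj : Disjoint (Ioo 0 x₀ ×ˢ Ioc 0 b) (O ∩ (Ioc x₀ a ×ˢ Ioc 0 b)) :=
    Set.disjoint_left.2 fun z hz hz' => (hz.1.2.trans hz'.2.1.1).false
  calc volume (D ∩ (Ioc 0 a ×ˢ Ioc 0 b))
      ≤ volume (D ∩ (Ioc 0 x₀ ×ˢ Ioc 0 b)) + volume (D ∩ (Ioc x₀ a ×ˢ Ioc 0 b)) := by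
        rw [← Ioc_union_Ioc_eq_Ioc hx₀ hx₀a, union_prod, inter_union_distrib_left]
        exact measure_union_le _ _
    _ ≤ ENNReal.ofReal (t * (x₀ * b)) +
          ENNReal.ofReal t * volume (O ∩ (Ioc x₀ a ×ˢ Ioc 0 b)) := add_le_add hleft hright
    _ = ENNReal.ofReal t * volume (Ioo 0 x₀ ×ˢ Ioc 0 b ∪ O ∩ (Ioc x₀ a ×ˢ Ioc 0 b)) := by
        rw [measure_union' hdisj (measurableSet_Ioo.prod measurableSet_Ioc), mul_add,
          Measure.volume_eq_prod, Measure.prod_prod, Real.volume_Ioo, Real.volume_Ioc, sub_zero,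
          sub_zero, ENNReal.ofReal_mul ht.le, ENNReal.ofReal_mul hx₀]
    _ ≤ _ := by
        gcongr
        refine union_subset (fun z hz => ⟨hcol hz, ⟨hz.1.1, hz.1.2.le.trans hx₀a⟩, hz.2⟩) ?_
        gcongr

end DecSet2

/-- The average of the indicator function of `D` over the rectangle `(0,x] × (0,y]`. -/
noncomputable def rectAvg (D : Set (ℝ × ℝ)) (z : ℝ × ℝ) : ℝ≥0∞ :=
  volume (D ∩ (Ioc 0 z.1 ×ˢ Ioc 0 z.2)) / ENNReal.ofReal (z.1 * z.2)

lemma rectAvg_le_one (D : Set (ℝ × ℝ)) {z : ℝ × ℝ} (hz : 0 < z.1) : rectAvg D z ≤ 1 := by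
  refine ENNReal.div_le_of_le_mul ?_
  rw [one_mul, ← volume_Ioc_prod_Ioc hz.le]
  exact measure_mono inter_subset_right

lemma mem_avgLevelSet_iff {D : Set (ℝ × ℝ)} {t : ℝ} (ht : 0 ≤ t) {z : ℝ × ℝ} (hz1 : 0 < z.1)
    (hz2 : 0 < z.2) : z ∈ avgLevelSet D t ↔ ENNReal.ofReal t ≤ rectAvg D z := by
  have hpos : 0 < z.1 * z.2 := mul_pos hz1 hz2
  rw [rectAvg, ENNReal.le_div_iff_mul_le (Or.inl (by simpa using hpos))
    (Or.inl ENNReal.ofReal_ne_top), ← ENNReal.ofReal_mul ht]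
  exact ⟨fun h => h.2, fun h => ⟨⟨hz1, hz2⟩, h⟩⟩

lemma DecSet2.rectAvg_le {D : Set (ℝ × ℝ)} (hD : DecSet2 D) {t : ℝ} (ht : 0 < t) (ht1 : t ≤ 1)
    {z : ℝ × ℝ} (hz1 : 0 < z.1) (hz2 : 0 < z.2) (h : z ∉ _root_.avgLevelSet D t) :
    rectAvg D z ≤ ENNReal.ofReal t * rectAvg (_root_.avgLevelSet D t) z := by
  rw [rectAvg, rectAvg, ← mul_div_assoc]
  refine ENNReal.div_le_div_right (hD.volume_inter_le ht ht1 hz1 hz2 ?_) _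
  exact le_of_not_ge fun hle => h ⟨⟨hz1, hz2⟩, hle⟩

/-- The part of `(0,∞)²` where the average of `D` lies in `[2⁻ʲ⁻¹, 2⁻ʲ)`. -/
def avgShell (D : Set (ℝ × ℝ)) (j : ℕ) : Set (ℝ × ℝ) :=
  avgLevelSet D ((1 / 2) ^ (j + 1)) \ avgLevelSet D ((1 / 2) ^ j)

lemma avgLevelSet_anti (D : Set (ℝ × ℝ)) {s t : ℝ} (h : s ≤ t) :
    avgLevelSet D t ⊆ avgLevelSet D s := fun _ hz =>
  ⟨hz.1, le_trans (ENNReal.ofReal_le_ofReal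
    (mul_le_mul_of_nonneg_right h (mul_pos hz.1.1 hz.1.2).le)) hz.2⟩

lemma avgLevelSet_half_pow_mono (D : Set (ℝ × ℝ)) :
    Monotone fun k : ℕ => avgLevelSet D ((1 / 2) ^ k) := fun _ _ h =>
  avgLevelSet_anti D (pow_le_pow_of_le_one (by norm_num) (by norm_num) h)

lemma pairwise_disjoint_avgShell (D : Set (ℝ × ℝ)) :
    Pairwise (Function.onFun Disjoint (avgShell D)) := by
  refine (pairwise_disjoint_on _).2 fun i j hij => ?_
  exact Set.disjoint_left.2 fun z hi hj => hj.2 (avgLevelSet_half_pow_mono D hij hi.1)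

lemma rectAvg_le_of_mem_avgShell {D : Set (ℝ × ℝ)} {j : ℕ} {z : ℝ × ℝ} (hz : z ∈ avgShell D j) :
    rectAvg D z ≤ ENNReal.ofReal ((1 / 2) ^ j) :=
  le_of_not_ge fun h => hz.2 ((mem_avgLevelSet_iff (by positivity) hz.1.1.1 hz.1.1.2).2 h)

lemma DecSet2.le_rectAvg_of_mem_avgShell {D : Set (ℝ × ℝ)} (hD : DecSet2 D) {j k : ℕ}
    (hkj : k ≤ j) {z : ℝ × ℝ} (hz : z ∈ avgShell D j) :
    ENNReal.ofReal ((1 / 2) ^ (j + 1 - k)) ≤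
      rectAvg (_root_.avgLevelSet D ((1 / 2) ^ k)) z := by
  have hz1 := hz.1.1.1
  have hz2 := hz.1.1.2
  have h1 := (mem_avgLevelSet_iff (by positivity) hz1 hz2).1 hz.1
  have h2 := hD.rectAvg_le (t := (1 / 2) ^ k) (by positivity)
    (pow_le_one₀ (by norm_num) (by norm_num)) hz1 hz2
    (fun h => hz.2 (avgLevelSet_half_pow_mono D hkj h))
  have h3 := h1.trans h2
  rw [show j + 1 = k + (j + 1 - k) by omega, pow_add, ENNReal.ofReal_mul (by positivity)] at h3
  exact (ENNReal.mul_le_mul_iff_right (by simp) ENNReal.ofReal_ne_top).1 h3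

lemma diff_subset_union_avgShell (D : Set (ℝ × ℝ)) :
    (Ioi (0 : ℝ) ×ˢ Ioi (0 : ℝ)) \ D ⊆
      ({z | rectAvg D z = 0} ∪ avgLevelSet D 1) ∪ ⋃ j, avgShell D j := by
  intro z hz
  have hz1 : 0 < z.1 := hz.1.1
  have hz2 : 0 < z.2 := hz.1.2
  by_cases h0 : rectAvg D z = 0
  · exact Or.inl (Or.inl h0)
  by_cases hL : z ∈ avgLevelSet D 1
  · exact Or.inl (Or.inr hL)
  have hfin : rectAvg D z ≠ ∞ := ((rectAvg_le_one D hz1).trans_lt ENNReal.one_lt_top).ne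
  obtain ⟨n, hn⟩ := exists_pow_lt_of_lt_one (ENNReal.toReal_pos h0 hfin)
    (by norm_num : (1 / 2 : ℝ) < 1)
  have hex : ∃ n : ℕ, z ∈ avgLevelSet D ((1 / 2) ^ n) := by
    refine ⟨n, (mem_avgLevelSet_iff (by positivity) hz1 hz2).2 ?_⟩
    exact ENNReal.ofReal_le_of_le_toReal hn.le
  classical
  obtain ⟨m, hm⟩ : ∃ m, Nat.find hex = m + 1 := by
    refine Nat.exists_eq_succ_of_ne_zero fun h => hL ?_
    have := Nat.find_spec hex
    rwa [h, pow_zero] at this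
  refine Or.inr (mem_iUnion.2 ⟨m, ?_, Nat.find_min hex (by omega)⟩)
  have := Nat.find_spec hex
  rwa [hm] at this

section Weight

variable {u : ℝ × ℝ → ℝ≥0} {p : ℝ}

lemma setLIntegral_rectAvg_le (hu : Measurable u) (hp : 0 ≤ p) (D : Set (ℝ × ℝ)) {A : Set (ℝ × ℝ)}
    {c : ℝ≥0∞} (h : ∀ z ∈ A, rectAvg D z ≤ c) :
    ∫⁻ z in A, rectAvg D z ^ p * (u z : ℝ≥0∞) ≤ c ^ p * ∫⁻ z in A, (u z : ℝ≥0∞) := by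
  rw [← lintegral_const_mul _ hu.coe_nnreal_ennreal]
  refine setLIntegral_mono (hu.coe_nnreal_ennreal.const_mul _) fun z hz => ?_
  gcongr
  exact h z hz

lemma le_setLIntegral_rectAvg (hu : Measurable u) (hp : 0 ≤ p) (D : Set (ℝ × ℝ))
    {A : Set (ℝ × ℝ)} (hA : NullMeasurableSet A) {c : ℝ≥0∞} (h : ∀ z ∈ A, c ≤ rectAvg D z) :
    c ^ p * ∫⁻ z in A, (u z : ℝ≥0∞) ≤ ∫⁻ z in A, rectAvg D z ^ p * (u z : ℝ≥0∞) := by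
  rw [← lintegral_const_mul _ hu.coe_nnreal_ennreal]
  refine lintegral_mono_ae ?_
  filter_upwards [ae_restrict_mem₀ hA] with z hz
  gcongr
  exact h z hz

/-- The `B_p` inequality for the weight `u` with the constant `C`. -/
def Bp2With (u : ℝ × ℝ → ℝ≥0) (p C : ℝ) : Prop :=
  ∀ D : Set (ℝ × ℝ), DecSet2 D →
    ∫⁻ z in (Ioi (0 : ℝ) ×ˢ Ioi (0 : ℝ)) \ D, rectAvg D z ^ p * (u z : ℝ≥0∞) ≤
      ENNReal.ofReal C * ∫⁻ z in D, (u z : ℝ≥0∞)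

namespace Bp2With

variable {C : ℝ} {D : Set (ℝ × ℝ)}

lemma weak_type (hC : Bp2With u p C) (hu : Measurable u) (hp : 0 ≤ p) (hD : DecSet2 D) {t : ℝ}
    (ht : 0 ≤ t) :
    ENNReal.ofReal t ^ p * ∫⁻ z in avgLevelSet D t \ D, (u z : ℝ≥0∞) ≤
      ENNReal.ofReal C * ∫⁻ z in D, (u z : ℝ≥0∞) := by
  refine (le_setLIntegral_rectAvg hu hp D
    ((hD.avgLevelSet t).nullMeasurableSet.diff hD.nullMeasurableSet) fun z hz =>
    (mem_avgLevelSet_iff ht hz.1.1.1 hz.1.1.2).1 hz.1).trans (le_trans ?_ (hC D hD))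
  exact lintegral_mono_set (sdiff_subset_sdiff_left (hD.avgLevelSet t).1)

lemma lintegral_avgLevelSet_one_le (hC : Bp2With u p C) (hu : Measurable u) (hp : 0 ≤ p)
    (hC0 : 0 ≤ C) (hD : DecSet2 D) :
    ∫⁻ z in avgLevelSet D 1, (u z : ℝ≥0∞) ≤
      ENNReal.ofReal (1 + C) * ∫⁻ z in D, (u z : ℝ≥0∞) := by
  have h := hC.weak_type hu hp hD zero_le_one
  rw [ENNReal.ofReal_one, ENNReal.one_rpow, one_mul] at h
  calc ∫⁻ z in avgLevelSet D 1, (u z : ℝ≥0∞)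
      ≤ ∫⁻ z in D ∪ avgLevelSet D 1 \ D, (u z : ℝ≥0∞) :=
        lintegral_mono_set (by rw [union_sdiff_self]; exact subset_union_right)
    _ ≤ _ := lintegral_union_le _ _ _
    _ ≤ (∫⁻ z in D, (u z : ℝ≥0∞)) + ENNReal.ofReal C * ∫⁻ z in D, (u z : ℝ≥0∞) := by gcongr
    _ = _ := by rw [ENNReal.ofReal_add zero_le_one hC0, ENNReal.ofReal_one, add_mul, one_mul]

lemma lintegral_avgShell_ne_top (hC : Bp2With u p C) (hu : Measurable u) (hp : 0 ≤ p)
    (hD : DecSet2 D) (hfin : ∫⁻ z in D, (u z : ℝ≥0∞) ≠ ∞) (j : ℕ) :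
    ∫⁻ z in avgShell D j, (u z : ℝ≥0∞) ≠ ∞ := by
  have h := hC.weak_type hu hp hD (t := (1 / 2) ^ (j + 1)) (by positivity)
  have hsub : avgShell D j ⊆ avgLevelSet D ((1 / 2) ^ (j + 1)) \ D :=
    sdiff_subset_sdiff_right (hD.subset_avgLevelSet (pow_le_one₀ (by norm_num) (by norm_num)))
  refine ne_top_of_le_ne_top (fun htop => ?_) (lintegral_mono_set hsub)
  rw [htop, ENNReal.mul_top, top_le_iff] at h
  · exact ENNReal.mul_ne_top ENNReal.ofReal_ne_top hfin h
  · rw [ENNReal.ofReal_rpow_of_pos (by positivity)]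
    simp only [ne_eq, ENNReal.ofReal_eq_zero, not_le]
    positivity

lemma sum_avgShell_le (hC : Bp2With u p C) (hu : Measurable u) (hp : 0 ≤ p) (hD : DecSet2 D)
    (k N : ℕ) :
    ∑ j ∈ Finset.Ico k N, ENNReal.ofReal ((1 / 2) ^ (j + 1 - k)) ^ p *
        ∫⁻ z in avgShell D j, (u z : ℝ≥0∞) ≤
      ENNReal.ofReal C * ∫⁻ z in avgLevelSet D ((1 / 2) ^ k), (u z : ℝ≥0∞) := by
  have hnull (j : ℕ) : NullMeasurableSet (avgShell D j) :=
    (hD.avgLevelSet _).nullMeasurableSet.diff (hD.avgLevelSet _).nullMeasurableSet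
  calc _ ≤ ∑ j ∈ Finset.Ico k N, ∫⁻ z in avgShell D j,
        rectAvg (avgLevelSet D ((1 / 2) ^ k)) z ^ p * (u z : ℝ≥0∞) :=
        Finset.sum_le_sum fun j hj => le_setLIntegral_rectAvg hu hp _ (hnull j) fun z hz =>
          hD.le_rectAvg_of_mem_avgShell (Finset.mem_Ico.1 hj).1 hz
    _ = ∫⁻ z in ⋃ j ∈ Finset.Ico k N, avgShell D j,
        rectAvg (avgLevelSet D ((1 / 2) ^ k)) z ^ p * (u z : ℝ≥0∞) :=
        (lintegral_biUnion_finset₀ (fun i _ j _ hij =>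
          (pairwise_disjoint_avgShell D hij).aedisjoint) (fun j _ => hnull j) _).symm
    _ ≤ _ := by
        refine (lintegral_mono_set (iUnion₂_subset fun j hj z hz => ?_)).trans
          (hC _ (hD.avgLevelSet _))
        exact ⟨hz.1.1, fun h => hz.2
          (avgLevelSet_half_pow_mono D (Finset.mem_Ico.1 hj).1 h)⟩

lemma lintegral_avgLevelSet_le_sum (u : ℝ × ℝ → ℝ≥0) (D : Set (ℝ × ℝ)) (k : ℕ) :
    ∫⁻ z in avgLevelSet D ((1 / 2) ^ k), (u z : ℝ≥0∞) ≤
      (∫⁻ z in avgLevelSet D 1, (u z : ℝ≥0∞)) +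
        ∑ i ∈ Finset.Ico 0 k, ∫⁻ z in avgShell D i, (u z : ℝ≥0∞) := by
  induction k with
  | zero => simp
  | succ k ih =>
    rw [Finset.sum_Ico_succ_top (Nat.zero_le k), ← add_assoc]
    calc _ ≤ ∫⁻ z in avgLevelSet D ((1 / 2) ^ k) ∪ avgShell D k, (u z : ℝ≥0∞) :=
          lintegral_mono_set (by
            rw [avgShell, union_sdiff_self]; exact subset_union_right)
      _ ≤ _ := lintegral_union_le _ _ _
      _ ≤ _ := by gcongr

lemma toReal_sum_avgShell_le (hC : Bp2With u p C) (hu : Measurable u) (hp : 0 ≤ p) (hC0 : 0 ≤ C)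
    (hD : DecSet2 D) (hfin : ∫⁻ z in D, (u z : ℝ≥0∞) ≠ ∞) (k N : ℕ) :
    ∑ j ∈ Finset.Ico k N, ((1 / 2 : ℝ) ^ p) ^ j *
        (∫⁻ z in avgShell D j, (u z : ℝ≥0∞)).toReal ≤
      C / (1 / 2 : ℝ) ^ p * ((1 / 2 : ℝ) ^ p) ^ k *
        ((∫⁻ z in avgLevelSet D 1, (u z : ℝ≥0∞)).toReal +
          ∑ i ∈ Finset.Ico 0 k, (∫⁻ z in avgShell D i, (u z : ℝ≥0∞)).toReal) := by
  have hshell := hC.lintegral_avgShell_ne_top hu hp hD hfin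
  have hone : ∫⁻ z in avgLevelSet D 1, (u z : ℝ≥0∞) ≠ ∞ :=
    ne_top_of_le_ne_top (ENNReal.mul_ne_top ENNReal.ofReal_ne_top hfin)
      (hC.lintegral_avgLevelSet_one_le hu hp hC0 hD)
  have h := (hC.sum_avgShell_le hu hp hD k N).trans
    (mul_le_mul_right (lintegral_avgLevelSet_le_sum u D k) _)
  have hsumfin : ∑ i ∈ Finset.Ico 0 k, ∫⁻ z in avgShell D i, (u z : ℝ≥0∞) ≠ ∞ :=
    ENNReal.sum_ne_top.2 fun i _ => hshell i
  have h' := ENNReal.toReal_mono (ENNReal.mul_ne_top ENNReal.ofReal_ne_top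
    (ENNReal.add_ne_top.2 ⟨hone, hsumfin⟩)) h
  have hpow (m : ℕ) : (ENNReal.ofReal ((1 / 2) ^ m) ^ p).toReal = ((1 / 2 : ℝ) ^ p) ^ m := by
    rw [← ENNReal.toReal_rpow, ENNReal.toReal_ofReal (by positivity),
      ← Real.rpow_pow_comm (by norm_num)]
  rw [ENNReal.toReal_mul, ENNReal.toReal_ofReal hC0, ENNReal.toReal_add hone hsumfin,
    ENNReal.toReal_sum fun i _ => hshell i, ENNReal.toReal_sum fun j _ =>
      ENNReal.mul_ne_top (ENNReal.rpow_ne_top_of_nonneg hp ENNReal.ofReal_ne_top) (hshell j)] at h'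
  simp_rw [ENNReal.toReal_mul, hpow] at h'
  set r := (1 / 2 : ℝ) ^ p
  have hr : 0 < r := by positivity
  calc _ = r ^ k / r * ∑ j ∈ Finset.Ico k N, r ^ (j + 1 - k) *
        (∫⁻ z in avgShell D j, (u z : ℝ≥0∞)).toReal := by
        rw [Finset.mul_sum]
        refine Finset.sum_congr rfl fun j hj => ?_
        have : r ^ k * r ^ (j + 1 - k) = r ^ j * r := by
          rw [← pow_add, ← pow_succ]
          congr 1
          have := (Finset.mem_Ico.1 hj).1
          omega
        rw [← mul_assoc, div_mul_eq_mul_div, this, mul_div_cancel_right₀ _ hr.ne']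
    _ ≤ r ^ k / r * (C * _) := mul_le_mul_of_nonneg_left h' (by positivity)
    _ = _ := by ring

end Bp2With

lemma lintegral_rectAvg_compl_le (hu : Measurable u) {q : ℝ} (hq : 0 < q) (D : Set (ℝ × ℝ)) :
    ∫⁻ z in (Ioi (0 : ℝ) ×ˢ Ioi (0 : ℝ)) \ D, rectAvg D z ^ q * (u z : ℝ≥0∞) ≤
      (∫⁻ z in avgLevelSet D 1, (u z : ℝ≥0∞)) +
        ∑' j, ENNReal.ofReal (((1 / 2 : ℝ) ^ q) ^ j) * ∫⁻ z in avgShell D j, (u z : ℝ≥0∞) := by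
  have hzero : ∫⁻ z in {z | rectAvg D z = 0}, rectAvg D z ^ q * (u z : ℝ≥0∞) ≤ 0 := by
    have := setLIntegral_rectAvg_le hu hq.le D (A := {z | rectAvg D z = 0}) (c := 0)
      fun z hz => le_of_eq hz
    rwa [ENNReal.zero_rpow_of_pos hq, zero_mul] at this
  have hone : ∫⁻ z in avgLevelSet D 1, rectAvg D z ^ q * (u z : ℝ≥0∞) ≤
      ∫⁻ z in avgLevelSet D 1, (u z : ℝ≥0∞) := by
    have := setLIntegral_rectAvg_le hu hq.le D (A := avgLevelSet D 1) (c := 1)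
      fun z hz => rectAvg_le_one D hz.1.1
    rwa [ENNReal.one_rpow, one_mul] at this
  calc _ ≤ _ := lintegral_mono_set (diff_subset_union_avgShell D)
    _ ≤ _ := lintegral_union_le _ _ _
    _ ≤ (0 + ∫⁻ z in avgLevelSet D 1, (u z : ℝ≥0∞)) +
        ∑' j, ∫⁻ z in avgShell D j, rectAvg D z ^ q * (u z : ℝ≥0∞) :=
        add_le_add ((lintegral_union_le _ _ _).trans (add_le_add hzero hone))
          (lintegral_iUnion_le _ _)
    _ ≤ _ := by
        rw [zero_add]
        gcongr with j
        refine (setLIntegral_rectAvg_le hu hq.le D fun z hz =>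
          rectAvg_le_of_mem_avgShell hz).trans (le_of_eq ?_)
        rw [ENNReal.ofReal_rpow_of_pos (by positivity), ← Real.rpow_pow_comm (by norm_num)]

end Weight

/-- If `1 ≤ p < ∞` and `u ∈ B_p((0,∞)²)`, then there exists `ε` with
`0 < ε < p` such that `u ∈ B_(p-ε)((0,∞)²)`. -/
theorem stmt13 (p : ℝ) (hp : 1 ≤ p) (u : ℝ × ℝ → ℝ≥0) (hu : Measurable u)
    (hloc : MeasureTheory.LocallyIntegrableOn (fun z => (u z : ℝ))
      (Set.Ioi 0 ×ˢ Set.Ioi 0))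
    (hBp : Bp2 u p) :
    ∃ ε : ℝ, 0 < ε ∧ ε < p ∧ Bp2 u (p - ε) := by
  obtain ⟨C, hC0, hC⟩ := hBp
  replace hC : Bp2With u p C := hC
  have hp0 : 0 < p := by linarith
  set r : ℝ := (1 / 2 : ℝ) ^ p with hrdef
  have hr : 0 < r := by positivity
  have hr1 : r < 1 := Real.rpow_lt_one (by norm_num) (by norm_num) hp0
  obtain ⟨θ, hθ1, hθr, hθ⟩ := exists_ratio_sum_le hr hr1 (div_pos hC0 hr)
  have hθpow : (2 : ℝ) ^ Real.logb 2 θ = θ :=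
    Real.rpow_logb (by norm_num) (by norm_num) (by linarith)
  have hratio : (1 / 2 : ℝ) ^ (p - Real.logb 2 θ) = θ * r := by
    rw [Real.rpow_sub (by norm_num), ← hrdef, one_div, Real.inv_rpow (by norm_num) (Real.logb 2 θ),
      hθpow, div_inv_eq_mul, mul_comm]
  have hεp : 0 < p - Real.logb 2 θ := by
    rw [← hratio] at hθr
    by_contra! hle
    exact hθr.not_ge (Real.one_le_rpow_of_pos_of_le_one_of_nonpos (by norm_num) (by norm_num) hle)
  set M : ℝ := 2 * (C / r) + 1
  have hM : 0 < M := by positivity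
  refine ⟨Real.logb 2 θ, Real.logb_pos (by norm_num) hθ1, by linarith, (1 + M) * (1 + C),
    by positivity, fun D hD => ?_⟩
  change ∫⁻ z in (Ioi (0 : ℝ) ×ˢ Ioi (0 : ℝ)) \ D,
    rectAvg D z ^ (p - Real.logb 2 θ) * (u z : ℝ≥0∞) ≤ _
  by_cases hfin : ∫⁻ z in D, (u z : ℝ≥0∞) = ∞
  · rw [hfin, ENNReal.mul_top (by simp only [ne_eq, ENNReal.ofReal_eq_zero, not_le]; positivity)]
    exact le_top
  have hone := hC.lintegral_avgLevelSet_one_le hu hp0.le hC0.le hD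
  have honefin : ∫⁻ z in avgLevelSet D 1, (u z : ℝ≥0∞) ≠ ∞ :=
    ne_top_of_le_ne_top (ENNReal.mul_ne_top ENNReal.ofReal_ne_top hfin) hone
  have hshell := hC.lintegral_avgShell_ne_top hu hp0.le hD hfin
  have hsum := hθ (∫⁻ z in avgLevelSet D 1, (u z : ℝ≥0∞)).toReal
    (fun j => (∫⁻ z in avgShell D j, (u z : ℝ≥0∞)).toReal) (fun _ => ENNReal.toReal_nonneg)
    ENNReal.toReal_nonneg (hC.toReal_sum_avgShell_le hu hp0.le hC0.le hD hfin)
  have htsum : ∑' j, ENNReal.ofReal ((θ * r) ^ j) * ∫⁻ z in avgShell D j, (u z : ℝ≥0∞) ≤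
      ENNReal.ofReal M * ∫⁻ z in avgLevelSet D 1, (u z : ℝ≥0∞) := by
    refine ENNReal.tsum_le_of_sum_range_le fun N => ?_
    rw [Finset.range_eq_Ico, ← ENNReal.ofReal_toReal honefin, ← ENNReal.ofReal_mul hM.le]
    refine le_trans (le_of_eq ?_) (ENNReal.ofReal_le_ofReal (hsum N))
    rw [ENNReal.ofReal_sum_of_nonneg fun j _ => by positivity]
    refine Finset.sum_congr rfl fun j _ => ?_
    rw [ENNReal.ofReal_mul (by positivity), ENNReal.ofReal_toReal (hshell j)]
  refine (lintegral_rectAvg_compl_le hu hεp D).trans ?_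
  rw [hratio]
  calc _ ≤ (∫⁻ z in avgLevelSet D 1, (u z : ℝ≥0∞)) +
        ENNReal.ofReal M * ∫⁻ z in avgLevelSet D 1, (u z : ℝ≥0∞) := by gcongr
    _ = ENNReal.ofReal (1 + M) * ∫⁻ z in avgLevelSet D 1, (u z : ℝ≥0∞) := by
        rw [ENNReal.ofReal_add zero_le_one hM.le, ENNReal.ofReal_one, add_mul, one_mul]
    _ ≤ ENNReal.ofReal (1 + M) * (ENNReal.ofReal (1 + C) * ∫⁻ z in D, (u z : ℝ≥0∞)) := by gcongr
    _ = _ := by rw [← mul_assoc, ← ENNReal.ofReal_mul (by positivity)]
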